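/- Let 0 < ε < 3, let U = [−ε/6, ε/6] regarded as a subset of 𝕋 = ℝ/2πℤ with λ(U) = ε/(6π) for the normalized Haar measure λ, let u = (1/λ(U)²)·(1_U ∗ 1_U), and let f(s) = e^{is} − 1. Then u ∈ A(𝕋), ‖u‖_{A(𝕋)} ≤ 6π/ε, ‖u‖_{L¹(𝕋)} = 1, supp u ⊆ U + U, and ‖f − f ∗ ǔ‖_{A(𝕋)} ≤ ε. -/

import Mathlib

open MeasureTheory AddCircle

noncomputable section

local instance : Fact (0 < 2 * Real.pi) := ⟨by positivity⟩

/-- The circle `𝕋 = ℝ/2πℤ`. -/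
abbrev Circle2Pi : Type := AddCircle (2 * Real.pi)

/-- Membership in the Fourier algebra `A(𝕋)`: continuity together with absolute
summability of the Fourier coefficients. -/
def MemFourierAlg (f : Circle2Pi → ℂ) : Prop :=
  Continuous f ∧ Summable fun n : ℤ => ‖fourierCoeff f n‖

/-- The norm of the Fourier algebra `A(𝕋)`: `‖f‖ = ∑ₙ |f̂(n)|`. -/
def fourierAlgNorm (f : Circle2Pi → ℂ) : ℝ :=
  ∑' n : ℤ, ‖fourierCoeff f n‖

/-- Normalized convolution on `𝕋` (with respect to the probability Haar measure). -/
def circleConv (f g : Circle2Pi → ℂ) : Circle2Pi → ℂ :=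
  fun x => ∫ y : Circle2Pi, f y * g (x - y) ∂haarAddCircle


open scoped Pointwise

lemma aux_conv_coeff (f g : Circle2Pi → ℂ) (hf : Integrable f haarAddCircle)
    (hg : Integrable g haarAddCircle) (n : ℤ) :
    fourierCoeff (circleConv f g) n = fourierCoeff f n * fourierCoeff g n := by
  have h := integral_convolution (ContinuousLinearMap.mul ℝ ℂ) (ν := haarAddCircle)
    (μ := haarAddCircle) (hf.fourier_smul (-n)) (hg.fourier_smul (-n))
  simp only [ContinuousLinearMap.mul_apply'] at h
  unfold fourierCoeff
  rw [← h]
  congr 1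
  ext x
  unfold circleConv convolution
  rw [← integral_smul]
  congr 1
  ext y
  have : (fourier (-n) x : ℂ) = fourier (-n) y * fourier (-n) (x - y) := by
    simp only [fourier_apply, ← Circle.coe_mul, ← toCircle_add, ← smul_add]
    simp
  simp only [ContinuousLinearMap.mul_apply', smul_eq_mul, this]
  ring

lemma aux_conv_int (f g : Circle2Pi → ℂ) (hf : Integrable f haarAddCircle)
    (hg : Integrable g haarAddCircle) : Integrable (circleConv f g) haarAddCircle := by
  have h := hf.integrable_convolution (ContinuousLinearMap.mul ℝ ℂ) hg
  have e : circleConv f g = convolution f g (ContinuousLinearMap.mul ℝ ℂ) haarAddCircle := by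
    funext x
    simp only [circleConv, convolution, ContinuousLinearMap.mul_apply']
  rw [e]
  exact h

lemma aux_neg_coeff (g : Circle2Pi → ℂ) (n : ℤ) :
    fourierCoeff (fun y => g (-y)) n = fourierCoeff g (-n) := by
  unfold fourierCoeff
  rw [← integral_neg_eq_self]
  congr 1
  ext x
  simp [fourier_apply]

lemma aux_U (a : ℝ) (ha : a < 3) :
    (fun x : ℝ => (x : Circle2Pi)) '' Set.Icc (-a) a = Metric.closedBall 0 a := by
  have hpi := Real.pi_gt_three
  ext x
  simp only [Set.mem_image, mem_closedBall_zero_iff, Set.mem_Icc, ← abs_le]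
  constructor
  · rintro ⟨t, ht, rfl⟩
    rw [(norm_coe_eq_abs_iff (p := 2 * Real.pi) (by positivity)).2]
    · exact ht
    · rw [abs_of_pos (a := 2 * Real.pi) (by positivity)]; linarith
  · intro hx
    have hx' : x ∈ (Set.univ : Set Circle2Pi) := trivial
    rw [← AddCircle.coe_image_Ioc_eq (2 * Real.pi) (-Real.pi)] at hx'
    obtain ⟨t, ht, rfl⟩ := hx'
    refine ⟨t, ?_, rfl⟩
    rwa [(norm_coe_eq_abs_iff (p := 2 * Real.pi) (by positivity)).2] at hx
    rw [abs_of_pos (a := 2 * Real.pi) (by positivity), abs_le]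
    constructor <;> linarith [ht.1, ht.2]

lemma aux_ac : (haarAddCircle : Measure Circle2Pi) ≪ volume := by
  rw [volume_eq_smul_haarAddCircle]
  exact Measure.absolutelyContinuous_smul (by simp [Real.pi_pos])

lemma aux_meas (a : ℝ) (ha0 : 0 < a) (ha : a < 3) :
    haarAddCircle (Metric.closedBall (0 : Circle2Pi) a) = ENNReal.ofReal (a / Real.pi) := by
  have hpi := Real.pi_gt_three
  have h := AddCircle.volume_closedBall (T := 2 * Real.pi) (x := 0) a
  rw [min_eq_right (by linarith), volume_eq_smul_haarAddCircle, Measure.smul_apply,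
    smul_eq_mul] at h
  have h2 : ENNReal.ofReal (2 * a) = ENNReal.ofReal (2 * Real.pi) * ENNReal.ofReal (a / Real.pi) := by
    rw [← ENNReal.ofReal_mul (by positivity)]
    congr 1
    field_simp
  rw [h2] at h
  exact (ENNReal.mul_right_inj (by simp [Real.pi_pos]) ENNReal.ofReal_ne_top).1 h

lemma aux_ae (a : ℝ) (x : Circle2Pi) :
    ∀ᵐ y ∂(haarAddCircle : Measure Circle2Pi), dist y x ≠ a := by
  have h := aux_ac.ae_le (AddCircle.closedBall_ae_eq_ball (T := 2 * Real.pi) (x := x) (ε := a)).mem_iff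
  filter_upwards [h] with y hy h1
  simp [Metric.mem_closedBall, Metric.mem_ball, h1] at hy

abbrev auxG (a : ℝ) : Circle2Pi → ℂ := (Metric.closedBall (0 : Circle2Pi) a).indicator fun _ => (1 : ℂ)

lemma auxG_norm (a : ℝ) (x : Circle2Pi) : ‖auxG a x‖ ≤ 1 := by
  unfold auxG Set.indicator
  split_ifs <;> simp

lemma auxG_sm (a : ℝ) : StronglyMeasurable (auxG a) :=
  stronglyMeasurable_const.indicator Metric.isClosed_closedBall.measurableSet

lemma auxG_int (a : ℝ) : Integrable (auxG a) haarAddCircle :=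
  (integrable_const (1 : ℂ)).indicator Metric.isClosed_closedBall.measurableSet

lemma aux_cont (a : ℝ) : Continuous (circleConv (auxG a) (auxG a)) := by
  rw [continuous_iff_continuousAt]
  intro x
  unfold circleConv
  apply continuousAt_of_dominated (bound := fun _ => (1 : ℝ))
  · refine Filter.Eventually.of_forall fun z => ?_
    exact ((auxG_sm a).mul ((auxG_sm a).comp_measurable (by fun_prop))).aestronglyMeasurable
  · refine Filter.Eventually.of_forall fun z => Filter.Eventually.of_forall fun y => ?_
    rw [norm_mul]
    exact mul_le_one₀ (auxG_norm a _) (norm_nonneg _) (auxG_norm a _)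
  · exact integrable_const _
  · filter_upwards [aux_ae a x] with y hy
    apply ContinuousAt.mul continuousAt_const
    have : ContinuousAt (auxG a) (x - y) := by
      refine ContinuousOn.continuousAt_indicator continuousOn_const ?_
      intro h
      have := Metric.frontier_closedBall_subset_sphere h
      rw [mem_sphere_zero_iff_norm] at this
      rw [dist_comm, dist_eq_norm] at hy
      exact hy this
    exact this.comp (f := fun z => z - y) (by fun_prop)

lemma aux_parseval (a : ℝ) (ha0 : 0 < a) (ha : a < 3) :
    HasSum (fun n : ℤ => ‖fourierCoeff (auxG a) n‖ ^ 2) (a / Real.pi) := by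
  have hL : MemLp (auxG a) 2 haarAddCircle :=
    (memLp_const (1 : ℂ)).indicator Metric.isClosed_closedBall.measurableSet
  have h := hasSum_sq_fourierCoeff (hL.toLp)
  rw [fourierCoeff_congr_ae hL.coeFn_toLp] at h
  convert h using 1
  have : (fun t => ‖hL.toLp (auxG a) t‖ ^ 2) =ᵐ[haarAddCircle]
      (Metric.closedBall (0 : Circle2Pi) a).indicator fun _ => (1 : ℝ) := by
    filter_upwards [hL.coeFn_toLp] with t ht
    rw [ht]
    unfold auxG Set.indicator
    split_ifs <;> simp
  rw [integral_congr_ae this, integral_indicator_const _ Metric.isClosed_closedBall.measurableSet,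
    measureReal_def, aux_meas a ha0 ha, ENNReal.toReal_ofReal (by positivity)]
  simp

lemma aux_zero (a : ℝ) (ha0 : 0 < a) (ha : a < 3) :
    fourierCoeff (auxG a) 0 = (a / Real.pi : ℝ) := by
  unfold fourierCoeff
  simp only [neg_zero, fourier_zero, one_smul]
  rw [integral_indicator_const _ Metric.isClosed_closedBall.measurableSet,
    measureReal_def, aux_meas a ha0 ha, ENNReal.toReal_ofReal (by positivity)]
  simp

lemma aux_one (a : ℝ) (ha0 : 0 < a) (ha : a < 3) :
    ‖fourierCoeff (auxG a) (-1) - fourierCoeff (auxG a) 0‖ ≤ a * (a / Real.pi) := by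
  unfold fourierCoeff
  rw [← integral_sub ((auxG_int a).fourier_smul _) ((auxG_int a).fourier_smul _)]
  have hm : MeasurableSet (Metric.closedBall (0 : Circle2Pi) a) :=
    Metric.isClosed_closedBall.measurableSet
  have : a * (a / Real.pi) = ∫ x, (Metric.closedBall (0 : Circle2Pi) a).indicator (fun _ => a) x
      ∂haarAddCircle := by
    rw [integral_indicator_const _ hm,
      measureReal_def, aux_meas a ha0 ha, ENNReal.toReal_ofReal (by positivity), smul_eq_mul, mul_comm]
  rw [this]
  refine norm_integral_le_of_norm_le ((integrable_const a).indicator hm)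
    (Filter.Eventually.of_forall fun x => ?_)
  by_cases hx : x ∈ Metric.closedBall (0 : Circle2Pi) a
  · simp only [auxG, Set.indicator_of_mem hx]
    rw [← aux_U a ha] at hx
    obtain ⟨t, ht, rfl⟩ := hx
    have h1 := Real.norm_exp_I_mul_ofReal_sub_one_le (x := t)
    have h2 : (fourier (-(-1)) ((t : ℝ) : Circle2Pi) : ℂ) = Complex.exp (Complex.I * t) := by
      rw [fourier_coe_apply]
      congr 1
      have : (Real.pi : ℂ) ≠ 0 := by exact_mod_cast Real.pi_ne_zero
      push_cast
      field_simp
      try simp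
    simp only [h2]
    simp only [neg_zero, fourier_zero, smul_eq_mul, mul_one]
    exact h1.trans (abs_le.2 ht)
  · simp [auxG, Set.indicator_of_notMem hx]

theorem stmt_14 (ε : ℝ) (hε0 : 0 < ε) (hε3 : ε < 3)
    (U : Set Circle2Pi) (hU : U = (fun x : ℝ => (x : Circle2Pi)) '' Set.Icc (-(ε / 6)) (ε / 6))
    (u : Circle2Pi → ℂ)
    (hu : u = fun x => ((6 * Real.pi / ε : ℝ) ^ 2 : ℂ) *
      circleConv (U.indicator fun _ => (1 : ℂ)) (U.indicator fun _ => (1 : ℂ)) x)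
    (f : Circle2Pi → ℂ) (hf : ∀ s : Circle2Pi, f s = fourier 1 s - 1) :
    haarAddCircle U = ENNReal.ofReal (ε / (6 * Real.pi)) ∧
    MemFourierAlg u ∧
    fourierAlgNorm u ≤ 6 * Real.pi / ε ∧
    (∫ x : Circle2Pi, ‖u x‖ ∂haarAddCircle) = 1 ∧
    tsupport u ⊆ U + U ∧
    fourierAlgNorm (fun x => f x - circleConv f (fun y => u (-y)) x) ≤ ε := by
  have hpi := Real.pi_gt_three
  obtain ⟨a, rfl⟩ : ∃ a, ε = 6 * a := ⟨ε / 6, by ring⟩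
  have ha0 : 0 < a := by linarith
  have ha : a < 3 := by linarith
  rw [show 6 * a / 6 = a by ring, aux_U a ha] at hU
  subst hU
  have hcc : 6 * Real.pi / (6 * a) = Real.pi / a := by field_simp
  rw [hcc] at hu ⊢
  have hc2 : 6 * a / (6 * Real.pi) = a / Real.pi := by field_simp
  rw [hc2]
  have hpiC : (Real.pi : ℂ) ≠ 0 := by exact_mod_cast Real.pi_ne_zero
  have haC : (a : ℂ) ≠ 0 := by exact_mod_cast ha0.ne'
  change u = fun x => (((Real.pi / a : ℝ) : ℂ) ^ 2) * circleConv (auxG a) (auxG a) x at hu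
  have hcoef : ∀ n, fourierCoeff u n = (((Real.pi / a : ℝ) : ℂ) ^ 2) * fourierCoeff (auxG a) n ^ 2 := by
    intro n
    rw [hu, fourierCoeff.const_mul, aux_conv_coeff _ _ (auxG_int a) (auxG_int a)]
    ring
  have hcont : Continuous u := by
    rw [hu]
    exact continuous_const.mul (aux_cont a)
  have hsum : HasSum (fun n : ℤ => ‖fourierCoeff u n‖) (Real.pi / a) := by
    have h := (aux_parseval a ha0 ha).mul_left ((Real.pi / a) ^ 2)
    have e1 : (Real.pi / a) ^ 2 * (a / Real.pi) = Real.pi / a := by field_simp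
    rw [e1] at h
    have e2 : (fun n : ℤ => ‖fourierCoeff u n‖) = fun n : ℤ => (Real.pi / a) ^ 2 * ‖fourierCoeff (auxG a) n‖ ^ 2 := by
      funext n
      rw [hcoef, norm_mul, norm_pow, norm_pow, Complex.norm_real, Real.norm_of_nonneg (by positivity)]
    rw [e2]
    exact h
  have hu0 : fourierCoeff u 0 = 1 := by
    rw [hcoef, aux_zero a ha0 ha]
    push_cast
    field_simp
  have huint : Integrable u haarAddCircle := hcont.integrable_of_hasCompactSupport
    (HasCompactSupport.of_compactSpace u)
  refine ⟨aux_meas a ha0 ha, ⟨hcont, hsum.summable⟩, hsum.tsum_eq.le, ?_, ?_, ?_⟩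
  · have hreal : ∀ x, u x = (‖u x‖ : ℂ) := by
      intro x
      let g : Circle2Pi → ℝ := (Metric.closedBall (0 : Circle2Pi) a).indicator fun _ => (1 : ℝ)
      have hg0 : ∀ y, 0 ≤ g y := fun y => Set.indicator_nonneg (fun _ _ => zero_le_one) y
      have hg : ∀ y, auxG a y = (g y : ℂ) := by
        intro y
        simp only [g, auxG, Set.indicator]
        split_ifs <;> simp
      have : u x = (((Real.pi / a) ^ 2 * ∫ y, g y * g (x - y) ∂haarAddCircle : ℝ) : ℂ) := by
        rw [hu]
        simp only [circleConv, hg]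
        rw [Complex.ofReal_mul, ← integral_complex_ofReal]
        push_cast
        rfl
      rw [this, Complex.norm_real, Real.norm_of_nonneg]
      exact mul_nonneg (by positivity) (integral_nonneg fun y => mul_nonneg (hg0 _) (hg0 _))
    have h1 : ((∫ x : Circle2Pi, ‖u x‖ ∂haarAddCircle : ℝ) : ℂ) = 1 := by
      rw [← integral_complex_ofReal, ← hu0]
      unfold fourierCoeff
      simp only [neg_zero, fourier_zero, one_smul, ← hreal]
    exact_mod_cast h1
  · have hcl : IsClosed (Metric.closedBall (0 : Circle2Pi) a + Metric.closedBall (0 : Circle2Pi) a) :=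
      ((Metric.isClosed_closedBall.isCompact).add (Metric.isClosed_closedBall.isCompact)).isClosed
    refine closure_minimal ?_ hcl
    intro x hx
    by_contra hn
    apply hx
    rw [hu]
    simp only [circleConv]
    rw [integral_eq_zero_of_ae, mul_zero]
    refine Filter.Eventually.of_forall fun y => ?_
    by_cases hy : y ∈ Metric.closedBall (0 : Circle2Pi) a
    · have : x - y ∉ Metric.closedBall (0 : Circle2Pi) a := fun h =>
        hn ⟨y, hy, x - y, h, by simp⟩
      simp [auxG, Set.indicator_of_notMem this]
    · simp [auxG, Set.indicator_of_notMem hy]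
  · obtain rfl : f = fun s => fourier 1 s - 1 := funext hf
    clear hf
    have hfc : Continuous (fun s : Circle2Pi => (fourier 1 s : ℂ) - 1) := by fun_prop
    have hfint : Integrable (fun s : Circle2Pi => (fourier 1 s : ℂ) - 1) haarAddCircle :=
      hfc.integrable_of_hasCompactSupport (HasCompactSupport.of_compactSpace _)
    have hvint : Integrable (fun y => u (-y)) haarAddCircle :=
      (hcont.comp continuous_neg).integrable_of_hasCompactSupport (HasCompactSupport.of_compactSpace _)
    have hcvint : Integrable (circleConv (fun s : Circle2Pi => (fourier 1 s : ℂ) - 1)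
        (fun y => u (-y))) haarAddCircle :=
      aux_conv_int _ _ hfint hvint
    have hfcoef : ∀ n, fourierCoeff (fun s : Circle2Pi => (fourier 1 s : ℂ) - 1) n
        = (if n = 1 then 1 else 0) - (if n = 0 then 1 else 0) := by
      intro n
      have e1 := congrFun (fourierCoeff_fourier (T := 2 * Real.pi) 1) n
      have e0 := congrFun (fourierCoeff_fourier (T := 2 * Real.pi) 0) n
      have i1 : ∀ m : ℤ, Integrable (fun s : Circle2Pi => (fourier m s : ℂ)) haarAddCircle := fun m =>
        (map_continuous (fourier m)).integrable_of_hasCompactSupport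
          (HasCompactSupport.of_compactSpace _)
      rw [Pi.single_apply] at e1 e0
      rw [← e1, ← e0]
      unfold fourierCoeff
      rw [← integral_sub ((i1 1).fourier_smul _) ((i1 0).fourier_smul _)]
      simp [mul_sub]
    have hd : ∀ n, fourierCoeff (fun x => ((fourier 1 x : ℂ) - 1) -
        circleConv (fun s : Circle2Pi => (fourier 1 s : ℂ) - 1) (fun y => u (-y)) x) n
        = if n = 1 then 1 - fourierCoeff u (-1) else 0 := by
      intro n
      have : fourierCoeff (fun x => ((fourier 1 x : ℂ) - 1) -
        circleConv (fun s : Circle2Pi => (fourier 1 s : ℂ) - 1) (fun y => u (-y)) x) n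
        = fourierCoeff (fun s : Circle2Pi => (fourier 1 s : ℂ) - 1) n -
          fourierCoeff (circleConv (fun s : Circle2Pi => (fourier 1 s : ℂ) - 1)
            (fun y => u (-y))) n := by
        unfold fourierCoeff
        rw [← integral_sub (hfint.fourier_smul _) (hcvint.fourier_smul _)]
        simp [mul_sub]
      rw [this, aux_conv_coeff _ _ hfint hvint, aux_neg_coeff, hfcoef]
      by_cases h1 : n = 1
      · subst h1; simp
      · by_cases h0 : n = 0
        · subst h0; simp [hu0]
        · simp [h1, h0]
    unfold fourierAlgNorm
    rw [tsum_eq_single 1 (by intro n hn; rw [hd, if_neg hn, norm_zero]), hd, if_pos rfl, hcoef]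
    set z := fourierCoeff (auxG a) (-1) with hz
    have hz1 := aux_one a ha0 ha
    rw [aux_zero a ha0 ha, ← hz] at hz1
    set w : ℂ := ((Real.pi / a : ℝ) : ℂ) * z with hw
    have hw1 : ‖w - 1‖ ≤ a := by
      have : w - 1 = ((Real.pi / a : ℝ) : ℂ) * (z - (a / Real.pi : ℝ)) := by
        rw [hw]; push_cast; field_simp
      rw [this, norm_mul, Complex.norm_real, Real.norm_of_nonneg (by positivity)]
      calc _ ≤ Real.pi / a * (a * (a / Real.pi)) := by gcongr
        _ = a := by field_simp
    have e : 1 - ((Real.pi / a : ℝ) : ℂ) ^ 2 * z ^ 2 = -((w - 1) * ((w - 1) + 2)) := by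
      rw [hw]; ring
    rw [e, norm_neg, norm_mul]
    have h3 : ‖(w - 1) + 2‖ ≤ a + 2 := (norm_add_le _ _).trans (by simpa using hw1)
    calc _ ≤ a * (a + 2) := by gcongr
      _ ≤ 6 * a := by nlinarith
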